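/- There exists a constant C > 0 such that every string graph G with m ≥ 2 edges has a separator consisting of at most C·√m·log m vertices. -/

import Mathlib

open Finset

/-- A curve from `x` to `y`: the image of a continuous map `[0,1] → ℝ²`
with prescribed endpoints. -/
def IsArc (c : Set (ℝ × ℝ)) (x y : ℝ × ℝ) : Prop :=
  ∃ f : ℝ → ℝ × ℝ, ContinuousOn f (Set.Icc 0 1) ∧ c = f '' Set.Icc 0 1 ∧
    f 0 = x ∧ f 1 = y

/-- A curve: the image of a continuous map `[0,1] → ℝ²`. -/
def IsCurve (c : Set (ℝ × ℝ)) : Prop := ∃ x y, IsArc c x y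

/-- `G` is a string graph: an intersection graph of curves in the plane. -/
def SimpleGraph.IsStringGraph {V : Type*} (G : SimpleGraph V) : Prop :=
  ∃ γ : V → Set (ℝ × ℝ), (∀ v, IsCurve (γ v)) ∧
    ∀ u v : V, (γ u ∩ γ v).Nonempty ↔ (G.Adj u v ∨ u = v)

/-- `S` is a separator in `G`. -/
def SimpleGraph.IsSeparator {V : Type*} [Fintype V] [DecidableEq V]
    (G : SimpleGraph V) (S : Finset V) : Prop :=
  ∃ V₁ V₂ : Finset V, V₁ ∪ V₂ ∪ S = Finset.univ ∧
    Disjoint V₁ V₂ ∧ Disjoint V₁ S ∧ Disjoint V₂ S ∧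
    3 * V₁.card ≤ 2 * Fintype.card V ∧ 3 * V₂.card ≤ 2 * Fintype.card V ∧
    ∀ u ∈ V₁, ∀ v ∈ V₂, ¬ G.Adj u v




lemma exists_log_real {g : ℝ → ℂ} (hg : Continuous g) (h0 : ∀ t, g t ≠ 0) :
    ∃ L : ℝ → ℂ, Continuous L ∧ ∀ t, Complex.exp (L t) = g t := by
  obtain ⟨F, ⟨-, hF⟩, -⟩ := Complex.isCoveringMapOn_exp.existsUnique_continuousMap_lifts
    (⟨g, hg⟩ : C(ℝ, ℂ)) (a₀ := 0) (Complex.exp_log (h0 0)) (fun a => h0 a)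
  exact ⟨F, F.continuous, fun t => congrFun hF t⟩

lemma exists_log_real2 {g : ℝ × ℝ → ℂ} (hg : Continuous g) (h0 : ∀ t, g t ≠ 0) :
    ∃ L : ℝ × ℝ → ℂ, Continuous L ∧ ∀ t, Complex.exp (L t) = g t := by
  obtain ⟨F, ⟨-, hF⟩, -⟩ := Complex.isCoveringMapOn_exp.existsUnique_continuousMap_lifts
    (⟨g, hg⟩ : C(ℝ × ℝ, ℂ)) (a₀ := 0) (Complex.exp_log (h0 0)) (fun a => h0 a)
  exact ⟨F, F.continuous, fun t => congrFun hF t⟩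

lemma log_diff {L M : ℝ → ℂ} (hL : Continuous L) (hM : Continuous M) (c : ℂ)
    (h : ∀ t, Complex.exp (L t) = c * Complex.exp (M t)) :
    L 1 - L 0 = M 1 - M 0 := by
  have key := Complex.isCoveringMap_exp.const_of_comp (g := fun t : ℝ => L t - M t) (hL.sub hM)
    (by
      intro a a'
      apply Subtype.ext
      simp only [Complex.exp_sub, h]
      rw [mul_div_assoc, mul_div_assoc, div_self (Complex.exp_ne_zero _),
        div_self (Complex.exp_ne_zero _)]) 1 0
  linear_combination key

lemma k5_nonplanar (p : Fin 5 → ℂ) (γ : Fin 5 → Fin 5 → ℝ → ℂ)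
    (hc : ∀ i j, i < j → Continuous (γ i j))
    (h0 : ∀ i j, i < j → γ i j 0 = p i) (h1 : ∀ i j, i < j → γ i j 1 = p j) :
    ∃ a b c d : Fin 5, a < b ∧ c < d ∧ a ≠ c ∧ a ≠ d ∧ b ≠ c ∧ b ≠ d ∧
      ∃ s t, γ a b s = γ c d t := by
  by_contra hcon
  push Not at hcon
  have hpt : ∀ v a b : Fin 5, a < b → v ≠ a → v ≠ b → ∀ t, γ a b t - p v ≠ 0 := by
    intro v a b hab hva hvb t
    have : ∃ w : Fin 5, w ≠ v ∧ w ≠ a ∧ w ≠ b := by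
      revert v a b; decide
    obtain ⟨w, hwv, hwa, hwb⟩ := this
    rw [sub_ne_zero]
    rcases lt_or_gt_of_ne hwv with h | h
    · rw [← h1 w v h]
      exact hcon a b w v hab h hwa.symm hva.symm hwb.symm hvb.symm t 1
    · rw [← h0 v w h]
      exact hcon a b v w hab h hva.symm hwa.symm hvb.symm hwb.symm t 0
  have hne : ∀ x y : Fin 5, x ≠ y → p y - p x ≠ 0 := by
    intro x y hxy
    have : ∃ w : Fin 5, w ≠ x ∧ w ≠ y := by
      revert x y; decide
    obtain ⟨w, hwx, hwy⟩ := this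
    rcases lt_or_gt_of_ne hwy with h | h
    · rw [← h1 w y h]
      exact hpt x w y h hwx.symm hxy 1
    · rw [← h0 y w h]
      exact hpt x y w h hxy hwx.symm 0
  let φ : Fin 5 → Fin 5 → ℂ := fun x y =>
    if x < y then Complex.log (p y - p x) else Complex.log (p x - p y) + Real.pi * Complex.I
  have hφ : ∀ x y, x ≠ y → Complex.exp (φ x y) = p y - p x := by
    intro x y hxy
    by_cases h : x < y
    · simp only [φ, h, if_true]
      exact Complex.exp_log (hne x y hxy)
    · simp only [φ, h, if_false]
      rw [Complex.exp_add, Complex.exp_log (hne y x hxy.symm), Complex.exp_pi_mul_I]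
      ring
  have hφ' : ∀ x y, x < y → φ y x = φ x y + Real.pi * Complex.I := by
    intro x y hxy
    simp only [φ, hxy, not_lt.mpr hxy.le, if_true, if_false]
  have hlog : ∀ v a b : Fin 5, ∃ L : ℝ → ℂ, a < b → v ≠ a → v ≠ b →
      Continuous L ∧ ∀ t, Complex.exp (L t) = γ a b t - p v := by
    intro v a b
    by_cases h : a < b ∧ v ≠ a ∧ v ≠ b
    · obtain ⟨L, hL⟩ := exists_log_real ((hc a b h.1).sub continuous_const)
        (hpt v a b h.1 h.2.1 h.2.2)
      exact ⟨L, fun _ _ _ => hL⟩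
    · exact ⟨0, fun h1 h2 h3 => absurd ⟨h1, h2, h3⟩ h⟩
  choose ℓ hℓ using hlog
  have hk : ∀ v a b : Fin 5, ∃ k : ℤ, a < b → v ≠ a → v ≠ b →
      ℓ v a b 1 - ℓ v a b 0 = φ v b - φ v a + k * (2 * Real.pi * Complex.I) := by
    intro v a b
    by_cases h : a < b ∧ v ≠ a ∧ v ≠ b
    · obtain ⟨hab, hva, hvb⟩ := h
      have e1 : Complex.exp (ℓ v a b 1 - ℓ v a b 0) = Complex.exp (φ v b - φ v a) := by
        rw [Complex.exp_sub, Complex.exp_sub, (hℓ v a b hab hva hvb).2,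
          (hℓ v a b hab hva hvb).2, hφ _ _ hvb, hφ _ _ hva, h0 _ _ hab, h1 _ _ hab]
      obtain ⟨k, hk⟩ := Complex.exp_eq_exp_iff_exists_int.1 e1
      exact ⟨k, fun _ _ _ => hk⟩
    · exact ⟨0, fun h1 h2 h3 => absurd ⟨h1, h2, h3⟩ h⟩
  choose k hk using hk
  have hsq : ∀ a b c d : Fin 5, a < b → c < d → a ≠ c → a ≠ d → b ≠ c → b ≠ d →
      (ℓ c a b 1 - ℓ c a b 0) + (ℓ b c d 1 - ℓ b c d 0) =
      (ℓ a c d 1 - ℓ a c d 0) + (ℓ d a b 1 - ℓ d a b 0) := by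
    intro a b c d hab hcd hac had hbc hbd
    obtain ⟨L, hLc, hL⟩ := exists_log_real2
      (g := fun x : ℝ × ℝ => γ a b x.1 - γ c d x.2)
      (((hc a b hab).comp continuous_fst).sub ((hc c d hcd).comp continuous_snd))
      (fun x => sub_ne_zero.2 (hcon a b c d hab hcd hac had hbc hbd x.1 x.2))
    have A1 := log_diff (L := fun s => L (s, 0)) (M := ℓ c a b) (by fun_prop)
      (hℓ c a b hab hac.symm hbc.symm).1 1 (by
        intro t; rw [hL, (hℓ c a b hab hac.symm hbc.symm).2, h0 _ _ hcd]; ring)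
    have A2 := log_diff (L := fun s => L (s, 1)) (M := ℓ d a b) (by fun_prop)
      (hℓ d a b hab had.symm hbd.symm).1 1 (by
        intro t; rw [hL, (hℓ d a b hab had.symm hbd.symm).2, h1 _ _ hcd]; ring)
    have A3 := log_diff (L := fun s => L (0, s)) (M := ℓ a c d) (by fun_prop)
      (hℓ a c d hcd hac had).1 (-1) (by
        intro t; rw [hL, (hℓ a c d hcd hac had).2, h0 _ _ hab]; ring)
    have A4 := log_diff (L := fun s => L (1, s)) (M := ℓ b c d) (by fun_prop)
      (hℓ b c d hcd hbc hbd).1 (-1) (by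
        intro t; rw [hL, (hℓ b c d hcd hbc hbd).2, h1 _ _ hab]; ring)
    linear_combination -A1 - A4 + A3 + A2
  let ε : Fin 5 → Fin 5 → ℤ := fun x y => if x < y then -1 else 1
  have hε : ∀ x y, x ≠ y → φ x y - φ y x = ε x y * (Real.pi * Complex.I) := by
    intro x y hxy
    rcases lt_or_gt_of_ne hxy with h | h
    · rw [hφ' x y h]; simp [ε, h]
    · rw [hφ' y x h]; simp [ε, not_lt.mpr h.le]
  have hint : ∀ a b c d : Fin 5, a < b → c < d → a ≠ c → a ≠ d → b ≠ c → b ≠ d →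
      2 * (k c a b + k b c d - k a c d - k d a b) = ε a d + ε d b + ε b c + ε c a := by
    intro a b c d hab hcd hac had hbc hbd
    have h := hsq a b c d hab hcd hac had hbc hbd
    rw [hk c a b hab hac.symm hbc.symm, hk b c d hcd hbc hbd, hk a c d hcd hac had,
      hk d a b hab had.symm hbd.symm] at h
    have e1 := hε a d had
    have e2 := hε d b hbd.symm
    have e3 := hε b c hbc
    have e4 := hε c a hac.symm
    have hpi : (Real.pi * Complex.I : ℂ) ≠ 0 := by simp [Real.pi_ne_zero]
    have : ((2 * (k c a b + k b c d - k a c d - k d a b) : ℤ) : ℂ) =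
        ((ε a d + ε d b + ε b c + ε c a : ℤ) : ℂ) := by
      apply mul_right_cancel₀ hpi
      push_cast
      linear_combination h + e1 + e2 + e3 + e4
    exact_mod_cast this
  have q1 := hint 0 1 2 3
  have q2 := hint 0 1 2 4
  have q3 := hint 0 1 3 4
  have q4 := hint 0 2 1 3
  have q5 := hint 0 2 1 4
  have q6 := hint 0 2 3 4
  have q7 := hint 0 3 1 2
  have q8 := hint 0 3 1 4
  have q9 := hint 0 3 2 4
  have q10 := hint 0 4 1 2
  have q11 := hint 0 4 1 3
  have q12 := hint 0 4 2 3
  have q13 := hint 1 2 3 4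
  have q14 := hint 1 3 2 4
  have q15 := hint 1 4 2 3
  simp [ε] at q1 q2 q3 q4 q5 q6 q7 q8 q9 q10 q11 q12 q13 q14 q15
  omega

/-- `T` contains the support of a walk from `u` to `v`. -/
def ConnIn {V : Type} (G : SimpleGraph V) (T : Finset V) (u v : V) : Prop :=
  ∃ p : G.Walk u v, ∀ x ∈ p.support, x ∈ T

lemma IsCurve.pathConn {c : Set (ℝ × ℝ)} (h : IsCurve c) : IsPathConnected c := by
  obtain ⟨x, y, f, hf, rfl, -, -⟩ := h
  exact ((convex_Icc (0:ℝ) 1).isPathConnected ⟨0, by simp⟩).image' hf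

lemma walk_joined {V : Type} (G : SimpleGraph V) (γ : V → Set (ℝ × ℝ))
    (hγ : ∀ v, IsCurve (γ v))
    (hG : ∀ u v : V, (γ u ∩ γ v).Nonempty ↔ (G.Adj u v ∨ u = v))
    {u v : V} (p : G.Walk u v) :
    ∀ x ∈ γ u, ∀ y ∈ γ v, JoinedIn (⋃ w ∈ p.support, γ w) x y := by
  induction p with
  | nil =>
    intro x hx y hy
    exact ((hγ _).pathConn.joinedIn x hx y hy).mono (by simp)
  | @cons a b c h q ih =>
    intro x hx y hy
    obtain ⟨z, hz1, hz2⟩ := (hG a b).2 (Or.inl h)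
    refine (((hγ a).pathConn.joinedIn x hx z hz1).mono ?_).trans ((ih z hz2 y hy).mono ?_)
    · intro t ht
      simp only [Set.mem_iUnion]
      exact ⟨a, by simp, ht⟩
    · intro t ht
      simp only [Set.mem_iUnion] at ht ⊢
      obtain ⟨w, hw, ht⟩ := ht
      exact ⟨w, by simp [hw], ht⟩

lemma string_cross {V : Type} {G : SimpleGraph V} (hG : G.IsStringGraph)
    (P : V × V → Finset V) (hP : ∀ q, ConnIn G (P q) q.1 q.2) (x : Fin 5 → V) :
    ∃ a b c d : Fin 5, a < b ∧ c < d ∧ a ≠ c ∧ a ≠ d ∧ b ≠ c ∧ b ≠ d ∧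
      ∃ w w', (w = w' ∨ G.Adj w w') ∧ w ∈ P (x a, x b) ∧ w' ∈ P (x c, x d) := by
  obtain ⟨γ, hγ, hG⟩ := hG
  have hpt : ∀ v, ∃ y, y ∈ γ v := fun v => (hγ v).pathConn.nonempty
  choose y hy using hpt
  have hj : ∀ i j : Fin 5, JoinedIn (⋃ w ∈ P (x i, x j), γ w) (y (x i)) (y (x j)) := by
    intro i j
    obtain ⟨p, hp⟩ := hP (x i, x j)
    refine (walk_joined G γ hγ hG p _ (hy _) _ (hy _)).mono ?_
    intro t ht
    simp only [Set.mem_iUnion] at ht ⊢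
    obtain ⟨w, hw, ht⟩ := ht
    exact ⟨w, hp w hw, ht⟩
  let e := Complex.equivRealProdCLM.symm
  obtain ⟨a, b, c, d, hab, hcd, h1, h2, h3, h4, s, t, hst⟩ :=
    k5_nonplanar (fun i => e (y (x i))) (fun i j t => e ((hj i j).somePath.extend t))
      (fun i j _ => e.continuous.comp (Path.continuous_extend _))
      (fun i j _ => by simp) (fun i j _ => by simp)
  have hst := e.injective hst
  have hmem : ∀ i j t, (hj i j).somePath.extend t ∈ ⋃ w ∈ P (x i, x j), γ w := by
    intro i j t
    have : (hj i j).somePath.extend t ∈ Set.range (hj i j).somePath.extend := ⟨t, rfl⟩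
    rw [Path.extend_range] at this
    obtain ⟨r, hr⟩ := this
    rw [← hr]
    exact (hj i j).somePath_mem r
  have m1 := hmem a b s
  have m2 := hmem c d t
  rw [← hst] at m2
  simp only [Set.mem_iUnion] at m1 m2
  obtain ⟨w, hw, m1⟩ := m1
  obtain ⟨w', hw', m2⟩ := m2
  exact ⟨a, b, c, d, hab, hcd, h1, h2, h3, h4, w, w', ((hG w w').1 ⟨_, m1, m2⟩).symm, hw, hw'⟩

open Classical in
/-- closed-neighbourhood size -/
noncomputable def cdeg {V : Type} [Fintype V] (G : SimpleGraph V) (w : V) : ℕ :=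
  (univ.filter fun w' => w = w' ∨ G.Adj w w').card

open Classical in
/-- congestion of a path system -/
noncomputable def cong {V : Type} [Fintype V] (P : V × V → Finset V) (w : V) : ℕ :=
  (univ.filter fun q => w ∈ P q).card

open Classical in
lemma count_tuples {V : Type} [Fintype V] (P : V × V → Finset V) (w w' : V)
    (a b c d : Fin 5) (hab : a < b) (hcd : c < d) (h1 : a ≠ c) (h2 : a ≠ d) (h3 : b ≠ c)
    (h4 : b ≠ d) :
    (univ.filter fun x : Fin 5 → V => w ∈ P (x a, x b) ∧ w' ∈ P (x c, x d)).card ≤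
      cong P w * cong P w' * Fintype.card V := by
  have : ∃ e : Fin 5, ∀ i, i = a ∨ i = b ∨ i = c ∨ i = d ∨ i = e := by
    revert a b c d; decide
  obtain ⟨e, he⟩ := this
  unfold cong
  rw [← Finset.card_univ, ← Finset.card_product, ← Finset.card_product]
  apply Finset.card_le_card_of_injOn (fun x => (((x a, x b), (x c, x d)), x e))
  · intro x hx
    simpa using hx
  · intro x _ y _ hxy
    simp only [Prod.mk.injEq] at hxy
    obtain ⟨⟨⟨ha, hb⟩, hc, hd⟩, hee⟩ := hxy
    funext i
    rcases he i with rfl | rfl | rfl | rfl | rfl <;> assumption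

open Classical in
lemma sum_rel_le {V : Type} [Fintype V] (G : SimpleGraph V) (c : V → ℕ) :
    ∑ q ∈ (univ : Finset (V × V)) with (q.1 = q.2 ∨ G.Adj q.1 q.2), c q.1 * c q.2 ≤
      ∑ w, cdeg G w * c w ^ 2 := by
  have e1 : ∑ q ∈ (univ : Finset (V × V)) with (q.1 = q.2 ∨ G.Adj q.1 q.2), c q.1 ^ 2 =
      ∑ w, cdeg G w * c w ^ 2 := by
    rw [Finset.sum_filter, Fintype.sum_prod_type]
    refine Finset.sum_congr rfl fun w _ => ?_
    dsimp only
    rw [← Finset.sum_filter, Finset.sum_const, cdeg, smul_eq_mul]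
  have e2 : ∑ q ∈ (univ : Finset (V × V)) with (q.1 = q.2 ∨ G.Adj q.1 q.2), c q.2 ^ 2 =
      ∑ w, cdeg G w * c w ^ 2 := by
    rw [Finset.sum_filter, Fintype.sum_prod_type_right]
    refine Finset.sum_congr rfl fun w _ => ?_
    dsimp only
    rw [← Finset.sum_filter, Finset.sum_const, cdeg, smul_eq_mul]
    congr 2
    ext v
    simp [eq_comm, G.adj_comm]
  have e3 : 2 * ∑ q ∈ (univ : Finset (V × V)) with (q.1 = q.2 ∨ G.Adj q.1 q.2), c q.1 * c q.2 ≤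
      ∑ q ∈ (univ : Finset (V × V)) with (q.1 = q.2 ∨ G.Adj q.1 q.2), (c q.1 ^ 2 + c q.2 ^ 2) := by
    rw [Finset.mul_sum]
    refine Finset.sum_le_sum fun q _ => ?_
    rw [← mul_assoc]
    exact two_mul_le_add_sq _ _
  rw [Finset.sum_add_distrib, e1, e2] at e3
  omega

open Classical in
lemma energy_lower {V : Type} [Fintype V] {G : SimpleGraph V} (hG : G.IsStringGraph)
    (P : V × V → Finset V) (hP : ∀ q, ConnIn G (P q) q.1 q.2) :
    (Fintype.card V) ^ 4 ≤ 625 * ∑ w, cdeg G w * cong P w ^ 2 := by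
  rcases Nat.eq_zero_or_pos (Fintype.card V) with h0 | hpos
  · simp [h0]
  have key : Fintype.card V ^ 5 ≤ 625 * ((∑ w, cdeg G w * cong P w ^ 2) * Fintype.card V) := by
    let Good : Finset (Fin 5 × Fin 5 × Fin 5 × Fin 5) := univ.filter fun z =>
      z.1 < z.2.1 ∧ z.2.2.1 < z.2.2.2 ∧ z.1 ≠ z.2.2.1 ∧ z.1 ≠ z.2.2.2 ∧ z.2.1 ≠ z.2.2.1 ∧
        z.2.1 ≠ z.2.2.2
    let Rel : Finset (V × V) := univ.filter fun q => (q.1 = q.2 ∨ G.Adj q.1 q.2)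
    have hsub : (univ : Finset (Fin 5 → V)) ⊆ Good.biUnion fun z => Rel.biUnion fun q =>
        univ.filter fun x : Fin 5 → V => q.1 ∈ P (x z.1, x z.2.1) ∧
          q.2 ∈ P (x z.2.2.1, x z.2.2.2) := by
      intro x _
      obtain ⟨a, b, c, d, hab, hcd, h1, h2, h3, h4, w, w', hw, m1, m2⟩ := string_cross hG P hP x
      simp only [Finset.mem_biUnion]
      refine ⟨(a, b, c, d), ?_, (w, w'), ?_, ?_⟩
      · simp only [Good, Finset.mem_filter]
        exact ⟨Finset.mem_univ _, hab, hcd, h1, h2, h3, h4⟩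
      · simp only [Rel, Finset.mem_filter]
        exact ⟨Finset.mem_univ _, hw⟩
      · simp only [Finset.mem_filter]
        exact ⟨Finset.mem_univ _, m1, m2⟩
    have h1 := Finset.card_le_card hsub
    rw [Finset.card_univ, Fintype.card_fun, Fintype.card_fin] at h1
    refine h1.trans ?_
    have h2 : ∀ z ∈ Good, (Rel.biUnion fun q =>
        univ.filter fun x : Fin 5 → V => q.1 ∈ P (x z.1, x z.2.1) ∧
          q.2 ∈ P (x z.2.2.1, x z.2.2.2)).card ≤
          (∑ w, cdeg G w * cong P w ^ 2) * Fintype.card V := by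
      intro z hz
      simp only [Good, Finset.mem_filter] at hz
      obtain ⟨-, g1, g2, g3, g4, g5, g6⟩ := hz
      refine Finset.card_biUnion_le.trans ?_
      refine (Finset.sum_le_sum fun q _ =>
        count_tuples P q.1 q.2 _ _ _ _ g1 g2 g3 g4 g5 g6).trans ?_
      rw [← Finset.sum_mul]
      exact Nat.mul_le_mul_right _ (sum_rel_le G (cong P))
    refine (Finset.card_biUnion_le_card_mul _ _ _ h2).trans ?_
    refine Nat.mul_le_mul_right _ ?_
    refine (Finset.card_le_univ _).trans ?_
    simp [Fintype.card_prod]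
  have : Fintype.card V ^ 4 * Fintype.card V ≤
      (625 * ∑ w, cdeg G w * cong P w ^ 2) * Fintype.card V := by
    calc _ = Fintype.card V ^ 5 := by ring
      _ ≤ _ := key
      _ = _ := by ring
  exact Nat.le_of_mul_le_mul_right this hpos

lemma ConnIn.left_mem {V : Type} {G : SimpleGraph V} {T : Finset V} {u v : V}
    (h : ConnIn G T u v) : u ∈ T := by
  obtain ⟨p, hp⟩ := h
  exact hp u p.start_mem_support

lemma ConnIn.right_mem {V : Type} {G : SimpleGraph V} {T : Finset V} {u v : V}
    (h : ConnIn G T u v) : v ∈ T := by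
  obtain ⟨p, hp⟩ := h
  exact hp v p.end_mem_support

lemma ConnIn.mono {V : Type} {G : SimpleGraph V} {T T' : Finset V} {u v : V}
    (h : ConnIn G T u v) (hT : T ⊆ T') : ConnIn G T' u v := by
  obtain ⟨p, hp⟩ := h
  exact ⟨p, fun x hx => hT (hp x hx)⟩

lemma ConnIn.symm {V : Type} {G : SimpleGraph V} {T : Finset V} {u v : V}
    (h : ConnIn G T u v) : ConnIn G T v u := by
  obtain ⟨p, hp⟩ := h
  exact ⟨p.reverse, fun x hx => hp x (by simpa using hx)⟩

lemma ConnIn.trans {V : Type} {G : SimpleGraph V} {T : Finset V} {u v w : V}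
    (h : ConnIn G T u v) (h' : ConnIn G T v w) : ConnIn G T u w := by
  obtain ⟨p, hp⟩ := h
  obtain ⟨q, hq⟩ := h'
  refine ⟨p.append q, fun x hx => ?_⟩
  rw [SimpleGraph.Walk.mem_support_append_iff] at hx
  exact hx.elim (hp x) (hq x)

lemma ConnIn.refl {V : Type} {G : SimpleGraph V} {T : Finset V} {u : V}
    (h : u ∈ T) : ConnIn G T u u :=
  ⟨SimpleGraph.Walk.nil, by simpa using h⟩

lemma ConnIn.adj {V : Type} {G : SimpleGraph V} {T : Finset V} {u v : V}
    (h : u ∈ T) (h' : v ∈ T) (ha : G.Adj u v) : ConnIn G T u v :=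
  ⟨SimpleGraph.Walk.cons ha SimpleGraph.Walk.nil, by simp [h, h']⟩

open Classical in
lemma cong_update {V : Type} [Fintype V] (P : V × V → Finset V) (q : V × V) (T : Finset V)
    (w : V) : cong (Function.update P q T) w + (if w ∈ P q then 1 else 0) =
      cong P w + (if w ∈ T then 1 else 0) := by
  have h : ∀ P : V × V → Finset V, cong P w = (if w ∈ P q then 1 else 0) +
      ∑ q' ∈ univ.erase q, (if w ∈ P q' then 1 else 0) := by
    intro P
    rw [cong, Finset.card_filter,
      ← Finset.add_sum_erase univ (fun q' => if w ∈ P q' then 1 else 0) (Finset.mem_univ q)]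
  rw [h, h P]
  have : ∑ q' ∈ univ.erase q, (if w ∈ Function.update P q T q' then 1 else 0) =
      ∑ q' ∈ univ.erase q, (if w ∈ P q' then 1 else 0) := by
    refine Finset.sum_congr rfl fun q' hq' => ?_
    rw [Function.update_of_ne (Finset.ne_of_mem_erase hq')]
  rw [this, Function.update_self]
  ring

open Classical in
lemma exists_weights {V : Type} [Fintype V] {G : SimpleGraph V} (hG : G.IsStringGraph)
    (hc : G.Connected) :
    ∃ (ω : V → ℕ) (D : V × V → ℕ), (∀ w, 1 ≤ ω w) ∧ ∑ w, ω w ≤ Fintype.card V ^ 4 ∧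
      (∀ q T, ConnIn G T q.1 q.2 → D q ≤ 3 * ∑ w ∈ T, ω w) ∧
      Fintype.card V ^ 4 * (∑ w, ω w) ^ 2 ≤ 625 * (∑ q, D q) ^ 2 * ∑ w, cdeg G w := by
  let good : Set (V × V → Finset V) := {P | ∀ q, ConnIn G (P q) q.1 q.2}
  have hne : good.Nonempty := ⟨fun _ => univ, fun q => by
    obtain ⟨p⟩ := hc.preconnected q.1 q.2
    exact ⟨p, fun x _ => Finset.mem_univ x⟩⟩
  obtain ⟨P, hP, hmin⟩ := Set.exists_min_image good
    (fun P => ∑ w, cdeg G w * cong P w ^ 2) (Set.toFinite _) hne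
  have hP : ∀ q, ConnIn G (P q) q.1 q.2 := hP
  have hcong : ∀ w, 1 ≤ cong P w := by
    intro w
    apply Finset.card_pos.2
    exact ⟨(w, w), by simpa using (hP (w, w)).left_mem⟩
  have hcdeg : ∀ w, 1 ≤ cdeg G w := by
    intro w
    apply Finset.card_pos.2
    exact ⟨w, by simp⟩
  have hcongle : ∀ w, cong P w ≤ Fintype.card V ^ 2 := by
    intro w
    refine (Finset.card_le_univ _).trans ?_
    rw [Fintype.card_prod, sq]
  have hcdegle : ∀ w, cdeg G w ≤ Fintype.card V := fun w => Finset.card_le_univ _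
  have hsum : ∑ q, ∑ w ∈ P q, cdeg G w * cong P w = ∑ w, cdeg G w * cong P w ^ 2 := by
    calc ∑ q, ∑ w ∈ P q, cdeg G w * cong P w
        = ∑ q, ∑ w, if w ∈ P q then cdeg G w * cong P w else 0 := by
          refine Finset.sum_congr rfl fun q _ => ?_
          rw [← Finset.sum_filter]
          congr 1
          ext; simp
      _ = ∑ w, ∑ q, if w ∈ P q then cdeg G w * cong P w else 0 := Finset.sum_comm
      _ = _ := by
          refine Finset.sum_congr rfl fun w _ => ?_
          rw [← Finset.sum_filter, Finset.sum_const, smul_eq_mul]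
          change cong P w * _ = _
          ring
  refine ⟨fun w => cdeg G w * cong P w, fun q => ∑ w ∈ P q, cdeg G w * cong P w,
    fun w => Nat.one_le_iff_ne_zero.2 (Nat.mul_ne_zero (by have := hcdeg w; omega)
      (by have := hcong w; omega)), ?_, ?_, ?_⟩
  · calc ∑ w, cdeg G w * cong P w ≤ ∑ _w : V, Fintype.card V * Fintype.card V ^ 2 :=
        Finset.sum_le_sum fun w _ => Nat.mul_le_mul (hcdegle w) (hcongle w)
      _ = _ := by rw [Finset.sum_const, Finset.card_univ, smul_eq_mul]; ring
  · intro q T hT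
    have h1 := hmin (Function.update P q T) (by
      intro q'
      by_cases h : q' = q
      · subst h; simpa using hT
      · rw [Function.update_of_ne h]; exact hP q')
    have h2 : ∑ w, (cdeg G w * cong (Function.update P q T) w ^ 2 +
        (if w ∈ P q then cdeg G w * cong P w else 0)) ≤
        ∑ w, (cdeg G w * cong P w ^ 2 + (if w ∈ T then 3 * (cdeg G w * cong P w) else 0)) := by
      refine Finset.sum_le_sum fun w _ => ?_
      have hu := cong_update P q T w
      have hw := hcong w
      generalize cong (Function.update P q T) w = c' at *
      generalize cong P w = c at *
      generalize cdeg G w = d at *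
      have : c' ^ 2 + (if w ∈ P q then c else 0) ≤ c ^ 2 + (if w ∈ T then 3 * c else 0) := by
        split_ifs at hu ⊢
        · have : c' = c := by omega
          subst this; omega
        · have : c = c' + 1 := by omega
          subst this; nlinarith
        · have : c' = c + 1 := by omega
          subst this; nlinarith
        · have : c' = c := by omega
          subst this; omega
      have := Nat.mul_le_mul_left d this
      split_ifs at this ⊢ <;> nlinarith
    rw [Finset.sum_add_distrib, Finset.sum_add_distrib, ← Finset.sum_filter,
      ← Finset.sum_filter, ← Finset.mul_sum] at h2
    simp only [Finset.filter_mem_eq_inter, Finset.univ_inter] at h2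
    dsimp only
    omega
  · have hE := energy_lower hG P hP
    dsimp only
    rw [hsum]
    set Φ := ∑ w, cdeg G w * cong P w ^ 2
    have hCS : (∑ w, cdeg G w * cong P w) ^ 2 ≤ (∑ w, cdeg G w) * Φ := by
      apply Finset.sum_sq_le_sum_mul_sum_of_sq_le_mul
      · intros; exact Nat.zero_le _
      · intros; exact Nat.zero_le _
      · intros; exact le_of_eq (by ring)
    calc _ ≤ (625 * Φ) * ((∑ w, cdeg G w) * Φ) := Nat.mul_le_mul hE hCS
      _ = _ := by ring

open Classical in
/-- weighted ball inside `U` -/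
noncomputable def wball {V : Type} [Fintype V] (G : SimpleGraph V) (ω : V → ℕ) (U : Finset V)
    (u : V) (r : ℕ) : Finset V :=
  univ.filter fun w => ∃ T ⊆ U, ConnIn G T u w ∧ ∑ x ∈ T, ω x ≤ r

open Classical in
/-- boundary of the weighted ball inside `U` -/
noncomputable def wbdry {V : Type} [Fintype V] (G : SimpleGraph V) (ω : V → ℕ) (U : Finset V)
    (u : V) (r : ℕ) : Finset V :=
  univ.filter fun w => w ∈ U ∧ w ∉ wball G ω U u r ∧ (w = u ∨ ∃ x ∈ wball G ω U u r, G.Adj x w)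

section balls
variable {V : Type} [Fintype V] {G : SimpleGraph V} {ω : V → ℕ} {U : Finset V} {u : V}

lemma mem_wball {r : ℕ} {w : V} : w ∈ wball G ω U u r ↔
    ∃ T ⊆ U, ConnIn G T u w ∧ ∑ x ∈ T, ω x ≤ r := by
  simp [wball]

lemma mem_wbdry {r : ℕ} {w : V} : w ∈ wbdry G ω U u r ↔ w ∈ U ∧ w ∉ wball G ω U u r ∧
    (w = u ∨ ∃ x ∈ wball G ω U u r, G.Adj x w) := by
  simp [wbdry]

lemma wball_mono {r s : ℕ} (h : r ≤ s) : wball G ω U u r ⊆ wball G ω U u s := by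
  intro w hw
  rw [mem_wball] at hw ⊢
  obtain ⟨T, h1, h2, h3⟩ := hw
  exact ⟨T, h1, h2, h3.trans h⟩

lemma wball_subset {r : ℕ} : wball G ω U u r ⊆ U := by
  intro w hw
  rw [mem_wball] at hw
  obtain ⟨T, h1, h2, h3⟩ := hw
  exact h1 h2.right_mem

lemma wball_mono_set {U' : Finset V} (h : U ⊆ U') {r : ℕ} :
    wball G ω U u r ⊆ wball G ω U' u r := by
  intro w hw
  rw [mem_wball] at hw ⊢
  obtain ⟨T, h1, h2, h3⟩ := hw
  exact ⟨T, h1.trans h, h2, h3⟩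

open Classical in
lemma wbdry_grow {r : ℕ} {w : V} (h : w ∈ wbdry G ω U u r) {s : ℕ} (hs : r + ω w ≤ s) :
    w ∈ wball G ω U u s := by
  rw [mem_wbdry] at h
  obtain ⟨hU, -, rfl | ⟨x, hx, hxw⟩⟩ := h
  · rw [mem_wball]
    exact ⟨{w}, by simpa using hU, ConnIn.refl (by simp), by simp; omega⟩
  · rw [mem_wball] at hx ⊢
    obtain ⟨T, h1, h2, h3⟩ := hx
    refine ⟨insert w T, Finset.insert_subset hU h1,
      (h2.mono (Finset.subset_insert _ _)).trans (ConnIn.adj ?_ (by simp) hxw), ?_⟩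
    · exact Finset.mem_insert_of_mem h2.right_mem
    · by_cases hw : w ∈ T
      · rw [Finset.insert_eq_of_mem hw]; omega
      · rw [Finset.sum_insert hw]; omega

lemma wbdry_later {r s : ℕ} {w : V} (h : w ∈ wbdry G ω U u r) (hs : r ≤ s) :
    w ∈ wball G ω U u s ∨ w ∈ wbdry G ω U u s := by
  by_cases hb : w ∈ wball G ω U u s
  · exact Or.inl hb
  · rw [mem_wbdry] at h ⊢
    obtain ⟨hU, -, rfl | ⟨x, hx, hxw⟩⟩ := h
    · exact Or.inr ⟨hU, hb, Or.inl rfl⟩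
    · exact Or.inr ⟨hU, hb, Or.inr ⟨x, wball_mono hs hx, hxw⟩⟩

open Classical in
lemma sum_wbdry_le (L : ℕ) : ∑ r ∈ range L, (wbdry G ω U u r).card ≤
    ∑ w ∈ wball G ω U u L ∪ wbdry G ω U u L, ω w := by
  have h1 : ∑ r ∈ range L, (wbdry G ω U u r).card =
      ∑ w, ((range L).filter fun r => w ∈ wbdry G ω U u r).card := by
    simp only [Finset.card_filter]
    rw [Finset.sum_comm]
    refine Finset.sum_congr rfl fun r _ => ?_
    rw [← Finset.card_filter]
    congr 1
    ext; simp
  rw [h1, ← Finset.sum_subset (Finset.subset_univ (wball G ω U u L ∪ wbdry G ω U u L))]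
  · refine Finset.sum_le_sum fun w _ => ?_
    rcases Finset.eq_empty_or_nonempty ((range L).filter fun r => w ∈ wbdry G ω U u r) with h | h
    · rw [h]; simp
    · obtain ⟨r0, hr0, hmin⟩ := Finset.exists_min_image _ id h
      have : ((range L).filter fun r => w ∈ wbdry G ω U u r) ⊆ Finset.Ico r0 (r0 + ω w) := by
        intro r hr
        rw [Finset.mem_Ico]
        refine ⟨hmin r hr, ?_⟩
        by_contra hcon
        have hb := wbdry_grow (Finset.mem_filter.1 hr0).2 (s := r) (by omega)
        exact (mem_wbdry.1 (Finset.mem_filter.1 hr).2).2.1 hb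
      simpa using Finset.card_le_card this
  · intro w _ hw
    rw [Finset.card_eq_zero, Finset.filter_eq_empty_iff]
    intro r hr hr'
    exact hw (Finset.mem_union.2 (wbdry_later hr' (Finset.mem_range.1 hr).le))

lemma exists_sparse_radius {ε : ℝ} (hε : 0 ≤ ε) {R : ℕ}
    (hR : 1 + ((∑ w, ω w : ℕ) : ℝ) < (1 + ε) ^ R) :
    ∃ r < R, ((wbdry G ω U u r).card : ℝ) ≤
      ε * (1 + ((∑ r' ∈ range r, (wbdry G ω U u r').card : ℕ) : ℝ)) := by
  by_contra hcon
  push Not at hcon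
  have : ∀ r ≤ R, (1 + ε) ^ r ≤ 1 + ((∑ r' ∈ range r, (wbdry G ω U u r').card : ℕ) : ℝ) := by
    intro r
    induction r with
    | zero => intro _; simp
    | succ r ih =>
      intro hr
      have h1 := ih (by omega)
      have h2 := hcon r (by omega)
      rw [Finset.sum_range_succ, pow_succ]
      push_cast at *
      nlinarith
  have h1 := this R le_rfl
  classical
  have h2 : (∑ r' ∈ range R, (wbdry G ω U u r').card) ≤ ∑ w, ω w :=
    (sum_wbdry_le R).trans (Finset.sum_le_sum_of_subset (Finset.subset_univ _))
  have h3 : ((∑ r' ∈ range R, (wbdry G ω U u r').card : ℕ) : ℝ) ≤ ((∑ w, ω w : ℕ) : ℝ) := by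
    exact_mod_cast h2
  linarith

end balls

/-- `S` separates `A` from the rest. -/
def CutP {V : Type} (G : SimpleGraph V) (A S : Finset V) : Prop :=
  Disjoint A S ∧ ∀ x ∈ A, ∀ y, y ∉ A → y ∉ S → ¬ G.Adj x y

lemma cut_ball {V : Type} [Fintype V] {G : SimpleGraph V} {ω : V → ℕ} {U : Finset V} {u : V}
    {r : ℕ} {x y : V} (hx : x ∈ wball G ω U u r) (hy : y ∈ U) (hy1 : y ∉ wball G ω U u r)
    (hy2 : y ∉ wbdry G ω U u r) : ¬ G.Adj x y := fun h =>
  hy2 (mem_wbdry.2 ⟨hy, hy1, Or.inr ⟨x, hx, h⟩⟩)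

open Classical in
lemma decomp {V : Type} [Fintype V] {G : SimpleGraph V} {ω : V → ℕ} {ε : ℝ} (hε : 0 ≤ ε) {R : ℕ}
    (hR : 1 + ((∑ w, ω w : ℕ) : ℝ) < (1 + ε) ^ R)
    (hball : ∀ u, 3 * (wball G ω univ u R).card ≤ Fintype.card V) :
    ∃ A S : Finset V, CutP G A S ∧ 3 * A.card ≤ 2 * Fintype.card V ∧
      3 * ((A ∪ S)ᶜ).card ≤ 2 * Fintype.card V ∧
      (S.card : ℝ) ≤ ε * ((∑ w ∈ A ∪ S, (ω w + 1) : ℕ) : ℝ) := by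
  let good : Set (Finset V × Finset V) := {Z | CutP G Z.1 Z.2 ∧ 3 * Z.1.card ≤ 2 * Fintype.card V ∧
    (Z.2.card : ℝ) ≤ ε * ((∑ w ∈ Z.1 ∪ Z.2, (ω w + 1) : ℕ) : ℝ)}
  have hne : good.Nonempty := ⟨(∅, ∅), ⟨by simp, by simp⟩, by simp, by simp⟩
  obtain ⟨⟨A, S⟩, ⟨hcut, hA, hS⟩, hmax⟩ := Set.exists_max_image good
    (fun Z => (Z.1 ∪ Z.2).card) (Set.toFinite _) hne
  simp only at hcut hA hS
  refine ⟨A, S, hcut, hA, ?_, hS⟩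
  by_contra hB
  push Not at hB
  set U := (A ∪ S)ᶜ with hU
  have hUne : U.Nonempty := by
    rw [← Finset.card_pos]; omega
  obtain ⟨u, hu⟩ := hUne
  obtain ⟨r, hrR, hr⟩ := exists_sparse_radius (G := G) (ω := ω) (U := U) (u := u) hε hR
  set A' := wball G ω U u r with hA'
  set S' := wbdry G ω U u r with hS'
  have hA'U : A' ⊆ U := wball_subset
  have hS'U : S' ⊆ U := fun w hw => (mem_wbdry.1 hw).1
  have huAS : u ∈ A' ∪ S' := by
    rw [Finset.mem_union]
    by_cases h : u ∈ A'
    · exact Or.inl h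
    · exact Or.inr (mem_wbdry.2 ⟨hu, h, Or.inl rfl⟩)
  have hA'S' : Disjoint A' S' := by
    rw [Finset.disjoint_left]
    intro w hw hw'
    exact (mem_wbdry.1 hw').2.1 hw
  have hdU : Disjoint (A ∪ S) U := disjoint_compl_right
  have hmemU : ∀ w, w ∈ U ↔ w ∉ A ∧ w ∉ S := by
    intro w; simp [hU]
  have hsub : A' ∪ S' ⊆ U := Finset.union_subset hA'U hS'U
  have hA'card : 3 * A'.card ≤ Fintype.card V := by
    refine le_trans ?_ (hball u)
    refine Nat.mul_le_mul_left 3 (Finset.card_le_card ?_)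
    exact (wball_mono hrR.le).trans (wball_mono_set (Finset.subset_univ _))
  have hunion : (A ∪ A') ∪ (S ∪ S') = (A ∪ S) ∪ (A' ∪ S') := by
    ext; simp only [Finset.mem_union]; tauto
  have hdisj2 : Disjoint (A ∪ S) (A' ∪ S') := Finset.disjoint_of_subset_right hsub hdU
  have hcardAS : A.card + S.card + U.card = Fintype.card V := by
    rw [← Finset.card_union_of_disjoint hcut.1, hU, Finset.card_add_card_compl]
  have hnew : (A ∪ A', S ∪ S') ∈ good := by
    refine ⟨⟨?_, ?_⟩, ?_, ?_⟩
    · dsimp only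
      rw [Finset.disjoint_left]
      intro w hw hw'
      rw [Finset.mem_union] at hw hw'
      rcases hw with hw | hw <;> rcases hw' with hw' | hw'
      · exact Finset.disjoint_left.1 hcut.1 hw hw'
      · exact ((hmemU w).1 (hS'U hw')).1 hw
      · exact ((hmemU w).1 (hA'U hw)).2 hw'
      · exact Finset.disjoint_left.1 hA'S' hw hw'
    · intro x hx y hy hy'
      simp only [Finset.mem_union, not_or] at hx hy hy'
      rcases hx with hx | hx
      · exact hcut.2 x hx y hy.1 hy'.1
      · exact cut_ball hx ((hmemU y).2 ⟨hy.1, hy'.1⟩) hy.2 hy'.2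
    · dsimp only
      have := Finset.card_union_le A A'
      omega
    · dsimp only
      rw [hunion, Finset.sum_union hdisj2]
      have h1 : (((S ∪ S').card : ℕ) : ℝ) ≤ S.card + S'.card := by
        exact_mod_cast Finset.card_union_le S S'
      have h2 : 1 + ∑ r' ∈ range r, (wbdry G ω U u r').card ≤ ∑ w ∈ A' ∪ S', (ω w + 1) := by
        rw [Finset.sum_add_distrib]
        have a1 := sum_wbdry_le (G := G) (ω := ω) (U := U) (u := u) r
        have a2 : 1 ≤ ∑ w ∈ A' ∪ S', 1 := by
          rw [Finset.sum_const, smul_eq_mul, mul_one]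
          exact Finset.card_pos.2 ⟨u, huAS⟩
        rw [← hA', ← hS'] at a1
        omega
      have h3 : (1 : ℝ) + ((∑ r' ∈ range r, (wbdry G ω U u r').card : ℕ) : ℝ) ≤
          ((∑ w ∈ A' ∪ S', (ω w + 1) : ℕ) : ℝ) := by exact_mod_cast h2
      have h4 := mul_le_mul_of_nonneg_left h3 hε
      push_cast at *
      linarith
  have := hmax _ hnew
  simp only at this
  rw [hunion, Finset.card_union_of_disjoint hdisj2] at this
  have : 0 < (A' ∪ S').card := Finset.card_pos.2 ⟨u, huAS⟩
  omega

open Classical in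
lemma sweep {V : Type} [Fintype V] {G : SimpleGraph V} (hc : G.Connected) {ω : V → ℕ}
    {D : V × V → ℕ} (hD : ∀ q T, ConnIn G T q.1 q.2 → D q ≤ 3 * ∑ w ∈ T, ω w)
    {R : ℕ} {X : ℝ} (hX : 0 < X)
    (hDX : 6 * (Fintype.card V : ℝ) * (Fintype.card V * R + X) ≤ ((∑ q, D q : ℕ) : ℝ)) (u : V) :
    ∃ r, R ≤ r ∧ ((wball G ω univ u r)ᶜ).Nonempty ∧
      ((wbdry G ω univ u r).card : ℝ) * X ≤
        ((∑ w, ω w : ℕ) : ℝ) * ((wball G ω univ u r)ᶜ).card := by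
  have : Nonempty V := ⟨u⟩
  have hN : 0 < Fintype.card V := Fintype.card_pos
  set W := ∑ w, ω w with hW
  have hex : ∀ v, v ∈ wball G ω univ u W := by
    intro v
    rw [mem_wball]
    obtain ⟨p⟩ := hc.preconnected u v
    exact ⟨univ, le_rfl, ⟨p, fun x _ => Finset.mem_univ x⟩, le_rfl⟩
  have hex' : ∀ v, ∃ r, v ∈ wball G ω univ u r := fun v => ⟨W, hex v⟩
  let d : V → ℕ := fun v => Nat.find (hex' v)
  have hd : ∀ v, v ∈ wball G ω univ u (d v) := fun v => Nat.find_spec (hex' v)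
  have hdW : ∀ v, d v ≤ W := fun v => Nat.find_min' (hex' v) (hex v)
  have hdr : ∀ v r, r < d v → v ∉ wball G ω univ u r := fun v r h => Nat.find_min (hex' v) h
  have hDd : ∀ q : V × V, D q ≤ 3 * (d q.1 + d q.2) := by
    intro q
    obtain ⟨T, -, h1, h2⟩ := mem_wball.1 (hd q.1)
    obtain ⟨T', -, h1', h2'⟩ := mem_wball.1 (hd q.2)
    refine (hD q (T ∪ T') ((h1.symm.mono Finset.subset_union_left).trans
      (h1'.mono Finset.subset_union_right))).trans ?_
    have : ∑ w ∈ T ∪ T', ω w ≤ ∑ w ∈ T, ω w + ∑ w ∈ T', ω w := by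
      rw [← Finset.sum_union_inter]; exact Nat.le_add_right _ _
    omega
  have hsumD : ∑ q, D q ≤ 6 * Fintype.card V * ∑ v, d v := by
    calc ∑ q, D q ≤ ∑ q : V × V, 3 * (d q.1 + d q.2) := Finset.sum_le_sum fun q _ => hDd q
      _ = _ := by
        rw [← Finset.mul_sum, Finset.sum_add_distrib, Fintype.sum_prod_type,
          Fintype.sum_prod_type_right]
        simp only [Finset.sum_const, Finset.card_univ, smul_eq_mul]
        rw [← Finset.mul_sum]
        ring
  have hsumd : ∑ v, d v ≤ Fintype.card V * R +
      ∑ r ∈ Finset.Ico R W, ((wball G ω univ u r)ᶜ).card := by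
    have h1 : ∑ r ∈ Finset.Ico R W, ((wball G ω univ u r)ᶜ).card =
        ∑ v, ((Finset.Ico R W).filter fun r => v ∉ wball G ω univ u r).card := by
      simp only [Finset.card_filter]
      rw [Finset.sum_comm]
      refine Finset.sum_congr rfl fun r _ => ?_
      rw [← Finset.card_filter]
      congr 1
      ext; simp
    rw [h1, ← Finset.card_univ, ← smul_eq_mul, ← Finset.sum_const, ← Finset.sum_add_distrib]
    refine Finset.sum_le_sum fun v _ => ?_
    have : Finset.Ico R (d v) ⊆ (Finset.Ico R W).filter fun r => v ∉ wball G ω univ u r := by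
      intro r hr
      rw [Finset.mem_Ico] at hr
      have := hdW v
      exact Finset.mem_filter.2 ⟨Finset.mem_Ico.2 ⟨hr.1, by omega⟩, hdr v r hr.2⟩
    have := Finset.card_le_card this
    rw [Nat.card_Ico] at this
    omega
  set O : ℕ := ∑ r ∈ Finset.Ico R W, ((wball G ω univ u r)ᶜ).card with hO
  have hXO : X ≤ O := by
    have h1 : ((∑ q, D q : ℕ) : ℝ) ≤ 6 * (Fintype.card V : ℝ) * (Fintype.card V * R + O) := by
      have := hsumD.trans (Nat.mul_le_mul_left _ hsumd)
      exact_mod_cast this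
    have h2 := hDX.trans h1
    have h3 : (0 : ℝ) < 6 * (Fintype.card V : ℝ) := by positivity
    have := le_of_mul_le_mul_left h2 h3
    linarith
  have hbW : ∑ r ∈ Finset.Ico R W, (wbdry G ω univ u r).card ≤ W := by
    refine le_trans ?_ ((sum_wbdry_le (G := G) (ω := ω) (U := univ) (u := u) W).trans
      (Finset.sum_le_sum_of_subset (Finset.subset_univ _)))
    refine Finset.sum_le_sum_of_subset ?_
    intro r hr
    exact Finset.mem_range.2 (Finset.mem_Ico.1 hr).2
  by_contra hcon
  push Not at hcon
  have hlt : ∑ r ∈ Finset.Ico R W, (W : ℝ) * ((wball G ω univ u r)ᶜ).card <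
      ∑ r ∈ Finset.Ico R W, ((wbdry G ω univ u r).card : ℝ) * X := by
    apply Finset.sum_lt_sum
    · intro r hr
      rcases Finset.eq_empty_or_nonempty ((wball G ω univ u r)ᶜ) with h | h
      · rw [h]; simp; positivity
      · exact (hcon r (Finset.mem_Ico.1 hr).1 h).le
    · by_contra hno
      push Not at hno
      have : O = 0 := by
        rw [hO]
        refine Finset.sum_eq_zero fun r hr => ?_
        rw [Finset.card_eq_zero]
        by_contra hne
        have h1 := hcon r (Finset.mem_Ico.1 hr).1 (Finset.nonempty_iff_ne_empty.2 hne)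
        have h2 := hno r hr
        linarith
      rw [this] at hXO
      simp at hXO
      linarith
  rw [← Finset.mul_sum, ← Finset.sum_mul] at hlt
  have h1 : (∑ r ∈ Finset.Ico R W, (((wball G ω univ u r)ᶜ).card : ℝ)) = O := by
    rw [hO]; push_cast; rfl
  have h2 : (∑ r ∈ Finset.Ico R W, ((wbdry G ω univ u r).card : ℝ)) ≤ W := by
    exact_mod_cast hbW
  rw [h1] at hlt
  have h3 := mul_le_mul_of_nonneg_right h2 hX.le
  have h4 : (W : ℝ) * X ≤ W * O := mul_le_mul_of_nonneg_left hXO (Nat.cast_nonneg _)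
  linarith

lemma sum_cdeg {V : Type} [Fintype V] (G : SimpleGraph V) :
    ∑ w, cdeg G w = Fintype.card V + 2 * Nat.card G.edgeSet := by
  classical
  have h : ∀ w, cdeg G w = 1 + G.degree w := by
    intro w
    rw [cdeg]
    have : (univ.filter fun w' => w = w' ∨ G.Adj w w') = insert w (G.neighborFinset w) := by
      ext v; simp [eq_comm]
    rw [this, Finset.card_insert_of_notMem (by simp), G.card_neighborFinset_eq_degree]
    ring
  simp only [h]
  rw [Finset.sum_add_distrib, G.sum_degrees_eq_twice_card_edges, Nat.card_eq_fintype_card,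
    ← SimpleGraph.edgeFinset_card]
  simp

lemma exp_aux (M : ℕ) (hM : (0:ℝ) < M) (R : ℕ) (hR : (0:ℝ) < R) :
    Real.exp (10 * Real.log M / R) ^ R = (M : ℝ) ^ 10 := by
  rw [← Real.exp_nat_mul, mul_div_cancel₀ _ hR.ne']
  have : (10 : ℝ) * Real.log M = ((10 : ℕ) : ℝ) * Real.log M := by norm_num
  rw [this, Real.exp_nat_mul, Real.exp_log hM]

lemma pow_aux {M n W : ℕ} (hM : 2 ≤ M) (h : n ≤ M + 1) (hW : W ≤ n ^ 4) : 1 + W < M ^ 10 := by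
  have a1 : n ≤ M ^ 2 := by nlinarith
  have a2 : W ≤ (M ^ 2) ^ 4 := hW.trans (Nat.pow_le_pow_left a1 4)
  have a3 : 1 ≤ M ^ 8 := Nat.one_le_pow _ _ (by omega)
  have a4 : 4 ≤ M ^ 2 := by nlinarith
  have a5 : M ^ 10 = M ^ 8 * M ^ 2 := by rw [← pow_add]
  have a6 : (M ^ 2) ^ 4 = M ^ 8 := by rw [← pow_mul]
  have a7 : M ^ 8 * 4 ≤ M ^ 8 * M ^ 2 := Nat.mul_le_mul_left _ a4
  omega

set_option maxHeartbeats 2000000 in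
open Classical in
lemma sparse_cut {V : Type} [Fintype V] {G : SimpleGraph V} (hG : G.IsStringGraph)
    (hc : G.Connected) {M : ℕ} (hM : 2 ≤ M) (hE : Nat.card G.edgeSet ≤ M)
    (hN : 288000 * (Real.sqrt M * Real.log M) < Fintype.card V) :
    ∃ A S : Finset V, CutP G A S ∧ A.Nonempty ∧ ((A ∪ S)ᶜ).Nonempty ∧
      (S.card : ℝ) * Fintype.card V ≤ 288000 * (Real.sqrt M * Real.log M) * A.card ∧
      (S.card : ℝ) * Fintype.card V ≤ 288000 * (Real.sqrt M * Real.log M) * ((A ∪ S)ᶜ).card := by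
  have hNM : Fintype.card V ≤ M + 1 := by
    have := hc.card_vert_le_card_edgeSet_add_one
    rw [Nat.card_eq_fintype_card] at this
    omega
  obtain ⟨ω, D, hω, hWle, hD, hmain⟩ := exists_weights hG hc
  rw [sum_cdeg] at hmain
  set n := Fintype.card V with hn
  set W := ∑ w, ω w with hW
  set E := ∑ q, D q with hEdef
  have hnW : n ≤ W := by
    rw [hn, hW, ← Finset.card_univ, Finset.card_eq_sum_ones]
    exact Finset.sum_le_sum fun w _ => hω w
  set s := Real.sqrt M with hs
  set l := Real.log M with hl
  have hM2 : (2 : ℝ) ≤ M := by exact_mod_cast hM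
  have hl2 : 1 / 2 ≤ l := by
    have h1 : Real.log 2 ≤ l := Real.log_le_log (by norm_num) hM2
    have := Real.log_two_gt_d9
    linarith
  have hs1 : 1 ≤ s := by
    rw [hs, Real.one_le_sqrt]; linarith
  have hss : s * s = M := Real.mul_self_sqrt (by linarith)
  have hs2 : s ≤ 2 * (s * l) := by nlinarith
  have hWN : (n : ℝ) ≤ W := by exact_mod_cast hnW
  have hnpos : (0 : ℝ) < n := by
    have : 0 ≤ s * l := by nlinarith
    linarith
  have hWpos : (0 : ℝ) < W := by linarith
  have hmainR : (n : ℝ) ^ 2 * W ≤ 50 * E * s := by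
    have h1 : (n : ℝ) ^ 4 * (W : ℝ) ^ 2 ≤ 625 * (E : ℝ) ^ 2 * (4 * M) := by
      have h2 : n + 2 * Nat.card G.edgeSet ≤ 4 * M := by omega
      have := hmain.trans (Nat.mul_le_mul_left _ h2)
      exact_mod_cast this
    refine le_of_sq_le_sq ?_ (by positivity)
    calc ((n : ℝ) ^ 2 * W) ^ 2 = (n : ℝ) ^ 4 * (W : ℝ) ^ 2 := by ring
      _ ≤ _ := h1
      _ = (50 * E * s) ^ 2 := by rw [← hss]; ring
  set ρ : ℝ := W / (600 * s) with hρ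
  have hspos : 0 < s := by linarith
  have hρs : ρ * (600 * s) = W := by rw [hρ]; field_simp
  have hρl : 480 * l ≤ ρ := by
    rw [hρ, le_div_iff₀ (by positivity)]
    nlinarith
  set R := ⌊ρ⌋₊ with hR
  have hρ0 : 0 ≤ ρ := by linarith
  have hRle : (R : ℝ) ≤ ρ := Nat.floor_le hρ0
  have hRge : ρ / 2 ≤ R := by
    have := Nat.lt_floor_add_one ρ
    linarith
  by_cases hcase : ∃ u, n < 3 * (wball G ω univ u R).card
  · obtain ⟨u, hu⟩ := hcase
    obtain ⟨r, hRr, hne, hr⟩ := sweep hc hD (R := R) (X := n * ρ) (by nlinarith) (by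
      rw [← hn, ← hEdef]
      have h1 : 6 * (n : ℝ) * (n * R + n * ρ) ≤ 12 * n ^ 2 * ρ := by
        have : (n : ℝ) * n * R ≤ n * n * ρ := mul_le_mul_of_nonneg_left hRle (by positivity)
        nlinarith
      refine h1.trans ?_
      have h2 : 12 * (n : ℝ) ^ 2 * ρ * (50 * s) ≤ E * (50 * s) := by
        calc 12 * (n : ℝ) ^ 2 * ρ * (50 * s) = (n : ℝ) ^ 2 * (ρ * (600 * s)) := by ring
          _ = (n : ℝ) ^ 2 * (W : ℝ) := by rw [hρs]
          _ ≤ _ := hmainR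
          _ = _ := by ring
      exact le_of_mul_le_mul_right h2 (by positivity)) u
    set A := wball G ω univ u r with hA
    set S := wbdry G ω univ u r with hS
    have hSA : S ⊆ Aᶜ := by
      intro w hw
      exact Finset.mem_compl.2 (mem_wbdry.1 hw).2.1
    have hdis : Disjoint A S := Finset.disjoint_of_subset_right hSA disjoint_compl_right
    have hAcard : n < 3 * A.card :=
      hu.trans_le (Nat.mul_le_mul_left 3 (Finset.card_le_card (wball_mono hRr)))
    have hout : (Aᶜ).card = S.card + ((A ∪ S)ᶜ).card := by
      have h1 := Finset.card_add_card_compl A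
      have h2 := Finset.card_add_card_compl (A ∪ S)
      rw [Finset.card_union_of_disjoint hdis] at h2
      omega
    have hOle : ((A ∪ S)ᶜ).card ≤ n := Finset.card_le_univ _
    rw [hout] at hr
    set O := ((A ∪ S)ᶜ).card with hO
    have hr' : (S.card : ℝ) * n ≤ 600 * s * (S.card + O) := by
      rw [← hW, ← hρs] at hr
      push_cast at hr
      have : ρ * ((S.card : ℝ) * n) ≤ ρ * (600 * s * (S.card + O)) := by linarith
      exact le_of_mul_le_mul_left this (by linarith)
    have hk : (S.card : ℝ) * n ≤ 1200 * s * O := by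
      have h1 : 1200 * s * (S.card : ℝ) ≤ n * S.card :=
        mul_le_mul_of_nonneg_right (by nlinarith) (Nat.cast_nonneg _)
      linarith
    have hk2 : (S.card : ℝ) * n ≤ 2400 * (s * l) * O := by
      refine hk.trans (mul_le_mul_of_nonneg_right (by linarith) (Nat.cast_nonneg _))
    have hsl : 0 ≤ s * l := by nlinarith
    refine ⟨A, S, ⟨hdis, fun x hx y hy hy' => cut_ball hx (Finset.mem_univ y) hy hy'⟩, ?_, ?_,
      ?_, ?_⟩
    · exact Finset.card_pos.1 (by omega)
    · rw [← Finset.card_pos, ← hO]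
      by_contra h0
      have h0 : O = 0 := by omega
      rw [h0] at hk
      simp only [Nat.cast_zero, mul_zero] at hk
      have hS0 : S.card = 0 := by
        by_contra h
        have : (0 : ℝ) < S.card := by exact_mod_cast Nat.pos_of_ne_zero h
        nlinarith
      have := Finset.card_pos.2 hne
      omega
    · have h1 : (O : ℝ) ≤ 3 * A.card := by
        have : O ≤ 3 * A.card := by omega
        exact_mod_cast this
      have h2 : s * l * O ≤ s * l * (3 * A.card) := mul_le_mul_of_nonneg_left h1 hsl
      have h3 : 0 ≤ s * l * (A.card : ℝ) := by positivity
      linarith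
    · have h3 : 0 ≤ s * l * (O : ℝ) := by positivity
      linarith
  · push Not at hcase
    have hRpos : (0 : ℝ) < R := by linarith
    have hx1 : 10 * l / R ≤ 1 := by
      rw [div_le_one hRpos]; linarith
    have hx0 : 0 ≤ 10 * l / R := by positivity
    set ε := Real.exp (10 * l / R) - 1 with hεd
    have hε0 : 0 ≤ ε := by
      have := Real.add_one_le_exp (10 * l / R)
      linarith
    have hε1 : ε ≤ 2 * (10 * l / R) := by
      have := Real.abs_exp_sub_one_le (x := 10 * l / R) (by rwa [abs_of_nonneg hx0])
      rw [abs_of_nonneg hx0] at this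
      exact (le_abs_self _).trans this
    have hpow : 1 + ((∑ w, ω w : ℕ) : ℝ) < (1 + ε) ^ R := by
      have h1 : (1 + ε) ^ R = (M : ℝ) ^ 10 := by
        have : (1 + ε) = Real.exp (10 * l / R) := by rw [hεd]; ring
        rw [this]; exact exp_aux M (by linarith) R hRpos
      rw [h1, ← hW]
      have h2 : 1 + W < M ^ 10 := pow_aux hM hNM hWle
      exact_mod_cast h2
    obtain ⟨A, S, hcut, hA, hB, hS⟩ := decomp hε0 hpow hcase
    have hcard : A.card + S.card + ((A ∪ S)ᶜ).card = n := by
      rw [← Finset.card_union_of_disjoint hcut.1, Finset.card_add_card_compl]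
    set B := (A ∪ S)ᶜ with hBdef
    have hSle : (S.card : ℝ) ≤ 48000 * (s * l) := by
      have h1 : ∑ w ∈ A ∪ S, (ω w + 1) ≤ 2 * W := by
        refine (Finset.sum_le_sum_of_subset (Finset.subset_univ _)).trans ?_
        rw [Finset.sum_add_distrib, Finset.sum_const, Finset.card_univ]
        simp only [smul_eq_mul, mul_one]
        omega
      have h2 : ((∑ w ∈ A ∪ S, (ω w + 1) : ℕ) : ℝ) ≤ 2 * W := by exact_mod_cast h1
      have h3 : 10 * l / R ≤ 10 * l / (ρ / 2) := by
        apply div_le_div_of_nonneg_left (by positivity) (by linarith) hRge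
      have h4 : ε ≤ 40 * l / ρ := by
        refine hε1.trans ((mul_le_mul_of_nonneg_left h3 (by norm_num)).trans (le_of_eq ?_))
        field_simp; norm_num
      calc (S.card : ℝ) ≤ ε * (2 * W) := hS.trans (mul_le_mul_of_nonneg_left h2 hε0)
        _ ≤ 40 * l / ρ * (2 * W) := mul_le_mul_of_nonneg_right h4 (by positivity)
        _ = 48000 * (s * l) := by
          rw [← hρs]
          have : ρ ≠ 0 := by
            have : 0 < ρ := by linarith
            exact this.ne'
          field_simp; norm_num
    have hA' : 3 * (A.card : ℝ) ≤ 2 * n := by exact_mod_cast hA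
    have hB' : 3 * (B.card : ℝ) ≤ 2 * n := by exact_mod_cast hB
    have hcard' : (A.card : ℝ) + S.card + B.card = n := by exact_mod_cast hcard
    have hA6 : (n : ℝ) ≤ 6 * A.card := by linarith
    have hB6 : (n : ℝ) ≤ 6 * B.card := by linarith
    have hS0 : (0 : ℝ) ≤ S.card := Nat.cast_nonneg _
    refine ⟨A, S, hcut, ?_, ?_, ?_, ?_⟩
    · rw [← Finset.card_pos]
      have : (0 : ℝ) < A.card := by linarith
      exact_mod_cast this
    · rw [← Finset.card_pos]
      have : (0 : ℝ) < B.card := by linarith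
      exact_mod_cast this
    · calc (S.card : ℝ) * n ≤ 48000 * (s * l) * (6 * A.card) :=
          mul_le_mul hSle hA6 hnpos.le (by linarith)
        _ = _ := by ring
    · calc (S.card : ℝ) * n ≤ 48000 * (s * l) * (6 * B.card) :=
          mul_le_mul hSle hB6 hnpos.le (by linarith)
        _ = _ := by ring

open Classical in
lemma cut_type {V : Type} [Fintype V] {G : SimpleGraph V} (hG : G.IsStringGraph)
    {M : ℕ} (hM : 2 ≤ M) (hE : Nat.card G.edgeSet ≤ M)
    (hN : 288000 * (Real.sqrt M * Real.log M) < Fintype.card V) :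
    ∃ A S : Finset V, CutP G A S ∧ A.Nonempty ∧ 2 * A.card ≤ Fintype.card V ∧
      (S.card : ℝ) * Fintype.card V ≤ 288000 * (Real.sqrt M * Real.log M) * A.card := by
  have key : ∃ A S : Finset V, CutP G A S ∧ A.Nonempty ∧ ((A ∪ S)ᶜ).Nonempty ∧
      (S.card : ℝ) * Fintype.card V ≤ 288000 * (Real.sqrt M * Real.log M) * A.card ∧
      (S.card : ℝ) * Fintype.card V ≤
        288000 * (Real.sqrt M * Real.log M) * ((A ∪ S)ᶜ).card := by
    have hl : 0 ≤ Real.log M := Real.log_natCast_nonneg M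
    by_cases hc : G.Connected
    · exact sparse_cut hG hc hM hE hN
    · have hpos : 0 < Fintype.card V := by
        have : 0 ≤ 288000 * (Real.sqrt M * Real.log M) := by positivity
        have : (0 : ℝ) < Fintype.card V := by linarith
        exact_mod_cast this
      have hV : Nonempty V := Fintype.card_pos_iff.1 hpos
      have : ¬ G.Preconnected := fun h => hc ⟨h⟩
      unfold SimpleGraph.Preconnected at this
      push Not at this
      obtain ⟨x, y, hxy⟩ := this
      refine ⟨univ.filter fun z => G.Reachable x z, ∅, ⟨by simp, ?_⟩, ⟨x, by simp⟩,
        ⟨y, by simpa using hxy⟩, ?_, ?_⟩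
      · intro a ha b hb _ hab
        simp only [Finset.mem_filter, Finset.mem_univ, true_and] at ha hb
        exact hb (ha.trans hab.reachable)
      · simp; positivity
      · simp; positivity
  obtain ⟨A, S, hcut, hA, hB, h1, h2⟩ := key
  have hcard : A.card + S.card + ((A ∪ S)ᶜ).card = Fintype.card V := by
    rw [← Finset.card_union_of_disjoint hcut.1, Finset.card_add_card_compl]
  by_cases hle : 2 * A.card ≤ Fintype.card V
  · exact ⟨A, S, hcut, hA, hle, h1⟩
  · refine ⟨(A ∪ S)ᶜ, S, ⟨?_, ?_⟩, hB, by omega, h2⟩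
    · rw [Finset.disjoint_left]
      intro w hw hw'
      simp [hw'] at hw
    · intro x hx y hy hy' hxy
      simp only [Finset.mem_compl, Finset.mem_union, not_or, not_and, not_not] at hx hy
      have hyA : y ∈ A := by
        by_contra h
        exact hy' (hy h)
      exact hcut.2 y hyA x hx.1 hx.2 hxy.symm

open Classical in
lemma cut_sub {V : Type} [Fintype V] {G : SimpleGraph V} (hG : G.IsStringGraph)
    {M : ℕ} (hM : 2 ≤ M) (hE : Nat.card G.edgeSet ≤ M) (B : Finset V)
    (hN : 288000 * (Real.sqrt M * Real.log M) < B.card) :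
    ∃ A S : Finset V, A ⊆ B ∧ S ⊆ B ∧ Disjoint A S ∧
      (∀ x ∈ A, ∀ y ∈ B, y ∉ A → y ∉ S → ¬ G.Adj x y) ∧ A.Nonempty ∧ 2 * A.card ≤ B.card ∧
      (S.card : ℝ) * B.card ≤ 288000 * (Real.sqrt M * Real.log M) * A.card := by
  let H : SimpleGraph {x // x ∈ B} := G.comap Subtype.val
  have hH : H.IsStringGraph := by
    obtain ⟨γ, h1, h2⟩ := hG
    refine ⟨fun v => γ v.1, fun v => h1 v.1, fun u v => ?_⟩
    rw [h2]
    exact or_congr Iff.rfl Subtype.ext_iff.symm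
  have hEH : Nat.card H.edgeSet ≤ M := by
    refine le_trans ?_ hE
    have f : H ↪g G := SimpleGraph.Embedding.comap (Function.Embedding.subtype _) G
    exact Nat.card_le_card_of_injective _ f.mapEdgeSet.injective
  have hcB : Fintype.card {x // x ∈ B} = B.card := Fintype.card_coe B
  obtain ⟨A, S, hcut, hA, h1, h2⟩ := cut_type hH hM hEH (by rw [hcB]; exact hN)
  rw [hcB] at h1 h2
  refine ⟨A.map (Function.Embedding.subtype _), S.map (Function.Embedding.subtype _),
    ?_, ?_, ?_, ?_, ?_, ?_, ?_⟩
  · intro x hx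
    simp only [Finset.mem_map, Function.Embedding.coe_subtype] at hx
    obtain ⟨a, -, rfl⟩ := hx
    exact a.2
  · intro x hx
    simp only [Finset.mem_map, Function.Embedding.coe_subtype] at hx
    obtain ⟨a, -, rfl⟩ := hx
    exact a.2
  · rw [Finset.disjoint_map]; exact hcut.1
  · intro x hx y hy hyA hyS hxy
    simp only [Finset.mem_map, Function.Embedding.coe_subtype] at hx hyA hyS
    obtain ⟨a, ha, rfl⟩ := hx
    exact hcut.2 a ha ⟨y, hy⟩ (fun h => hyA ⟨_, h, rfl⟩) (fun h => hyS ⟨_, h, rfl⟩) hxy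
  · exact hA.map
  · simpa using h1
  · simpa using h2

/-- **Theorem (Matoušek).** There is a constant `C > 0` such that every string graph
with `m ≥ 2` edges has a separator with at most `C·√m·log m` vertices. -/
theorem string_graph_separator :
    ∃ C : ℝ, 0 < C ∧
      ∀ (V : Type) [Fintype V] [DecidableEq V] (G : SimpleGraph V) [DecidableRel G.Adj],
        G.IsStringGraph → 2 ≤ G.edgeFinset.card →
        ∃ S : Finset V, G.IsSeparator S ∧
          (S.card : ℝ) ≤
            C * Real.sqrt (G.edgeFinset.card) * Real.log (G.edgeFinset.card) := by
  refine ⟨432000, by norm_num, ?_⟩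
  intro V _ _ G _ hG hM
  have hE : Nat.card G.edgeSet ≤ G.edgeFinset.card := by
    rw [Nat.card_eq_fintype_card, SimpleGraph.edgeFinset_card]
  set M := G.edgeFinset.card with hMd
  have hl : 0 ≤ Real.log M := Real.log_natCast_nonneg M
  set β := Real.sqrt M * Real.log M with hβ
  have hβ0 : 0 ≤ β := by positivity
  rw [mul_assoc, ← hβ]
  by_cases hsmall : (Fintype.card V : ℝ) ≤ 432000 * β
  · exact ⟨univ, ⟨∅, ∅, by simp⟩, by rwa [Finset.card_univ]⟩
  push Not at hsmall
  set n := Fintype.card V with hn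
  let good : Set (Finset V × Finset V) := {Z | CutP G Z.1 Z.2 ∧ 3 * Z.1.card ≤ 2 * n ∧
    2 * (n : ℝ) * Z.2.card ≤ 3 * (288000 * β) * Z.1.card}
  have hne : good.Nonempty := ⟨(∅, ∅), ⟨by simp, by simp⟩, by simp, by simp⟩
  obtain ⟨⟨A, S⟩, ⟨hcut, hA, hS⟩, hmax⟩ := Set.exists_max_image good
    (fun Z => Z.1.card) (Set.toFinite _) hne
  simp only at hcut hA hS
  have hnpos : (0 : ℝ) < n := by linarith
  have hA' : 3 * (A.card : ℝ) ≤ 2 * n := by exact_mod_cast hA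
  have hcard : A.card + S.card + ((A ∪ S)ᶜ).card = n := by
    rw [← Finset.card_union_of_disjoint hcut.1, Finset.card_add_card_compl]
  set B := (A ∪ S)ᶜ with hB
  have hmemB : ∀ w, w ∈ B ↔ w ∉ A ∧ w ∉ S := by
    intro w; simp [hB]
  have hBle : 3 * B.card ≤ 2 * n := by
    by_contra hcon
    push Not at hcon
    have hcon' : 2 * (n : ℝ) < 3 * B.card := by exact_mod_cast hcon
    obtain ⟨A', S', hA'B, hS'B, hdis, hadj, hne', hle', hS'⟩ := cut_sub hG hM hE B
      (by rw [← hβ]; linarith)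
    rw [← hβ] at hS'
    have hAA' : Disjoint A A' := by
      rw [Finset.disjoint_left]
      intro w hw hw'
      exact ((hmemB w).1 (hA'B hw')).1 hw
    have hnew : (A ∪ A', S ∪ S') ∈ good := by
      refine ⟨⟨?_, ?_⟩, ?_, ?_⟩
      · dsimp only
        rw [Finset.disjoint_left]
        intro w hw hw'
        rw [Finset.mem_union] at hw hw'
        rcases hw with hw | hw <;> rcases hw' with hw' | hw'
        · exact Finset.disjoint_left.1 hcut.1 hw hw'
        · exact ((hmemB w).1 (hS'B hw')).1 hw
        · exact ((hmemB w).1 (hA'B hw)).2 hw'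
        · exact Finset.disjoint_left.1 hdis hw hw'
      · intro x hx y hy hy'
        simp only [Finset.mem_union, not_or] at hx hy hy'
        rcases hx with hx | hx
        · exact hcut.2 x hx y hy.1 hy'.1
        · exact hadj x hx y ((hmemB y).2 ⟨hy.1, hy'.1⟩) hy.2 hy'.2
      · dsimp only
        rw [Finset.card_union_of_disjoint hAA']
        omega
      · dsimp only
        rw [Finset.card_union_of_disjoint hAA']
        have h1 : (((S ∪ S').card : ℕ) : ℝ) ≤ S.card + S'.card := by
          exact_mod_cast Finset.card_union_le S S'
        have h2 := mul_le_mul_of_nonneg_left h1 (by positivity : 0 ≤ 2 * (n : ℝ))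
        have h3 := mul_le_mul_of_nonneg_left hcon'.le (Nat.cast_nonneg S'.card : (0 : ℝ) ≤ _)
        push_cast
        linarith
    have h1 := hmax _ hnew
    simp only at h1
    rw [Finset.card_union_of_disjoint hAA'] at h1
    have := Finset.card_pos.2 hne'
    omega
  refine ⟨S, ⟨A, B, ?_, ?_, hcut.1, ?_, hA, hBle, ?_⟩, ?_⟩
  · ext w
    simp only [Finset.mem_union, hmemB, Finset.mem_univ, iff_true]
    tauto
  · rw [Finset.disjoint_left]
    intro w hw hw'
    exact ((hmemB w).1 hw').1 hw
  · rw [Finset.disjoint_left]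
    intro w hw hw'
    exact ((hmemB w).1 hw).2 hw'
  · intro u hu v hv
    exact hcut.2 u hu v ((hmemB v).1 hv).1 ((hmemB v).1 hv).2
  · have h1 : 2 * (n : ℝ) * S.card ≤ 2 * n * (288000 * β) := by
      refine hS.trans ?_
      have := mul_le_mul_of_nonneg_right hA' (by positivity : 0 ≤ 288000 * β)
      linarith
    have := le_of_mul_le_mul_left h1 (by positivity)
    linarith
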